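/- Let A be a unital simple separable C*-algebra which is approximately divisible and stably finite, let X be a compact metric space, and assume that C(X,A) has strict comparison of positive elements with respect to tracial states. Suppose f ∈ C(X,A) is positive and q ∈ C(X,A) is a projection satisfying d_τ(q) < d_τ(f) for every tracial state τ on C(X,A). Then there exist a projection p ∈ C(X,A) that is Murray–von Neumann equivalent to q and a positive element b in the norm closure of f·C(X,A)·f such that bp = pb = 0 and d_τ(f) = d_τ(b) + d_τ(p) for every tracial state τ on C(X,A). -/

import Mathlib

open Filter Topology

/-- Cuntz subequivalence: `a ≾ b` iff there is a sequence `vₙ` with `‖vₙ * b * vₙ* - a‖ → 0`. -/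
def CuntzLE {B : Type*} [NonUnitalNormedRing B] [StarRing B] (a b : B) : Prop :=
  ∃ v : ℕ → B, Tendsto (fun n => ‖v n * b * star (v n) - a‖) atTop (𝓝 0)

/-- Cuntz equivalence: `a ≾ b` and `b ≾ a`. -/
def CuntzEquiv {B : Type*} [NonUnitalNormedRing B] [StarRing B] (a b : B) : Prop :=
  CuntzLE a b ∧ CuntzLE b a

/-- A projection: a self-adjoint idempotent. -/
def IsProjection {B : Type*} [Mul B] [Star B] (p : B) : Prop :=
  star p = p ∧ p * p = p

/-- Murray–von Neumann equivalence of projections. -/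
def MvNEquiv {B : Type*} [Mul B] [Star B] (p q : B) : Prop :=
  ∃ v : B, star v * v = p ∧ v * star v = q

/-- A tracial state on a unital C*-algebra: a unital positive linear functional `τ`
with `τ(xy) = τ(yx)`. -/
def IsTracialState {B : Type*} [CStarAlgebra B] [PartialOrder B] (τ : B → ℂ) : Prop :=
  (∀ x y : B, τ (x + y) = τ x + τ y) ∧ (∀ (c : ℂ) (x : B), τ (c • x) = c * τ x) ∧
  τ 1 = 1 ∧ (∀ a : B, 0 ≤ a → 0 ≤ (τ a).re ∧ (τ a).im = 0) ∧
  (∀ x y : B, τ (x * y) = τ (y * x))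

/-- The dimension function `d_τ(a) = lim_{n→∞} τ(a^{1/n})` associated to a tracial state,
with `a^{1/n}` given by the continuous functional calculus. -/
noncomputable def dTr {B : Type*} [CStarAlgebra B] (τ : B → ℂ) (a : B) : ℝ :=
  limUnder atTop (fun n : ℕ => (τ (cfc (fun t : ℝ => t ^ (n : ℝ)⁻¹) a)).re)

/-- Strict comparison of positive elements with respect to tracial states:
`a ≾ b` whenever `d_τ(a) < d_τ(b)` for every tracial state `τ`. -/
def StrictComparison (B : Type*) [CStarAlgebra B] [PartialOrder B] : Prop :=
  ∀ a b : B, 0 ≤ a → 0 ≤ b →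
    (∀ τ : B → ℂ, IsTracialState τ → dTr τ a < dTr τ b) → CuntzLE a b

/-- A unital C*-algebra is approximately divisible if for each `N` there is an
approximately central sequence of unital *-homomorphisms `M_N(ℂ) ⊕ M_{N+1}(ℂ) → A`. -/
def ApproxDivisible (A : Type*) [CStarAlgebra A] : Prop :=
  ∀ N : ℕ, ∃ φ : ℕ → ((Matrix (Fin N) (Fin N) ℂ × Matrix (Fin (N + 1)) (Fin (N + 1)) ℂ) →⋆ₐ[ℂ] A),
    ∀ z, ∀ a : A, Tendsto (fun k => ‖φ k z * a - a * φ k z‖) atTop (𝓝 0)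

/-- Real rank zero: every self-adjoint element is a norm limit of self-adjoint
elements with finite spectrum. -/
def RealRankZero (A : Type*) [CStarAlgebra A] : Prop :=
  ∀ a : A, IsSelfAdjoint a → ∀ ε : ℝ, 0 < ε →
    ∃ b : A, IsSelfAdjoint b ∧ (spectrum ℂ b).Finite ∧ ‖a - b‖ < ε

/-- Stably finite: every isometry in every matrix algebra over `A` is a unitary. -/
def StablyFinite (A : Type*) [CStarAlgebra A] : Prop :=
  ∀ n : ℕ, ∀ v : Matrix (Fin n) (Fin n) A, star v * v = 1 → v * star v = 1

/-- Simplicity: no nontrivial closed two-sided ideals. -/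
def CStarSimple (A : Type*) [CStarAlgebra A] : Prop :=
  ∀ I : TwoSidedIdeal A, IsClosed (I : Set A) → I = ⊥ ∨ I = ⊤

/-- The hereditary subalgebra generated by a positive element `f`: the norm closure
of `{ f x f : x ∈ B }`. -/
def herSet {B : Type*} [NonUnitalNormedRing B] (f : B) : Set B :=
  closure {y : B | ∃ x : B, y = f * x * f}

lemma cuntzLE_refl {B : Type*} [NormedRing B] [StarRing B] (a : B) : CuntzLE a a :=
  ⟨fun _ => 1, by simp⟩

lemma cuntzEquiv_refl {B : Type*} [NormedRing B] [StarRing B] (a : B) : CuntzEquiv a a :=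
  ⟨cuntzLE_refl a, cuntzLE_refl a⟩

noncomputable instance CStarAlgebra.instContinuousSqrt {A : Type*} [CStarAlgebra A]
    [PartialOrder A] [StarOrderedRing A] : ContinuousSqrt A where
  sqrt x := CFC.sqrt (x.2 - x.1)
  continuousOn_sqrt :=
    CFC.continuousOn_sqrt.comp (by fun_prop) fun _ hx => sub_nonneg.2 hx
  sqrt_nonneg _ _ := CFC.sqrt_nonneg _
  sqrt_mul_sqrt x hx := by
    rw [CFC.sqrt_mul_sqrt_self _ (sub_nonneg.2 hx), add_sub_cancel]

lemma tendsto_const_rpow_inv {c : ℝ} (hc : 0 < c) :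
    Tendsto (fun n : ℕ => c ^ ((n : ℝ)⁻¹)) atTop (𝓝 1) := by
  have h := (Real.continuous_const_rpow hc.ne').continuousAt.tendsto.comp
    (tendsto_inv_atTop_nhds_zero_nat (𝕜 := ℝ))
  rwa [Real.rpow_zero] at h

lemma IsProjection.one_sub {R : Type*} [Ring R] [StarRing R] {p : R} (hp : IsProjection p) :
    IsProjection (1 - p) :=
  ⟨by rw [star_sub, star_one, hp.1], by rw [mul_sub, sub_mul, sub_mul, hp.2]; simp⟩

lemma IsTracialState.re_smul {B : Type*} [CStarAlgebra B] [PartialOrder B] {τ : B → ℂ}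
    (hτ : IsTracialState τ) (c : ℝ) (a : B) :
    (τ (c • a)).re = c * (τ a).re := by
  have h := hτ.2.1 (c : ℂ) a
  rw [Complex.coe_smul] at h
  rw [h, Complex.re_ofReal_mul]

section CStar

variable {B : Type*} [CStarAlgebra B] [PartialOrder B] [StarOrderedRing B]

lemma CFC.smul_rpow {c y : ℝ} (hc : 0 ≤ c) (hy : 0 ≤ y) {a : B} (ha : 0 ≤ a) :
    (c • a) ^ y = c ^ y • a ^ y := by
  have hcont : Continuous fun t : ℝ => t ^ y := Real.continuous_rpow_const hy
  rw [CFC.rpow_eq_cfc_real (smul_nonneg hc ha), CFC.rpow_eq_cfc_real ha,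
    ← cfc_comp_smul c _ a hcont.continuousOn, ← cfc_smul _ _ _ hcont.continuousOn]
  refine cfc_congr fun t ht => ?_
  simp [Real.mul_rpow hc (spectrum_nonneg_of_nonneg ha ht)]

lemma CFC.pow_rpow_inv {n : ℕ} (hn : n ≠ 0) {a : B} (ha : 0 ≤ a) :
    (a ^ n) ^ ((n : ℝ)⁻¹) = a := by
  rw [← CFC.rpow_natCast a n, CFC.rpow_rpow_of_exponent_nonneg _ _ _ (by positivity)
    (by positivity), mul_inv_cancel₀ (by exact_mod_cast hn), CFC.rpow_one a]

lemma CFC.rpow_inv_pow {n : ℕ} (hn : n ≠ 0) {a : B} (ha : 0 ≤ a) :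
    (a ^ ((n : ℝ)⁻¹)) ^ n = a := by
  rw [← CFC.rpow_natCast _ n, CFC.rpow_rpow_of_exponent_nonneg _ _ _ (by positivity)
    (by positivity), inv_mul_cancel₀ (by exact_mod_cast hn), CFC.rpow_one a]

lemma IsProjection.nonneg {p : B} (hp : IsProjection p) : 0 ≤ p := by
  have h := star_mul_self_nonneg p
  rwa [hp.1, hp.2] at h

lemma CFC.add_rpow_inv_of_mul_eq_zero {p b : B} (hp : IsProjection p) (hb : 0 ≤ b)
    (hbp : b * p = 0) (hpb : p * b = 0) {n : ℕ} (hn : n ≠ 0) :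
    (b + p) ^ ((n : ℝ)⁻¹) = b ^ ((n : ℝ)⁻¹) + p := by
  set c := b ^ ((n : ℝ)⁻¹) with hc
  have hc0 : 0 ≤ c := CFC.rpow_nonneg
  have hcn : c ^ n = b := CFC.rpow_inv_pow hn hb
  have hcomm : Commute c p := by
    rw [hc, CFC.rpow_def]
    exact Commute.cfc_nnreal (hbp.trans hpb.symm) _
  have hpn : ∀ m : ℕ, m ≠ 0 → p ^ m = p := fun m hm =>
    (show IsIdempotentElem p from hp.2).pow_eq hm
  have hcp : c * p = 0 := by
    have h0 : 0 ≤ c * p := hcomm.mul_nonneg hc0 hp.nonneg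
    have h1 : (c * p) ^ n = 0 := by rw [hcomm.mul_pow, hcn, hpn n hn, hbp]
    rw [← CFC.pow_rpow_inv hn h0, h1]
    exact CFC.zero_rpow (inv_ne_zero (by exact_mod_cast hn))
  have hpc : p * c = 0 := hcomm.eq.symm.trans hcp
  have key : ∀ m : ℕ, (c + p) ^ (m + 1) = c ^ (m + 1) + p := by
    intro m
    induction m with
    | zero => simp
    | succ m ih =>
      rw [pow_succ, ih, mul_add, add_mul, add_mul, hpc, hp.2, pow_succ c m, mul_assoc _ c p, hcp,
        pow_succ c (m + 1), pow_succ c m]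
      simp
  obtain ⟨m, rfl⟩ := Nat.exists_eq_succ_of_ne_zero hn
  rw [← CFC.pow_rpow_inv hn (add_nonneg hc0 hp.nonneg), Nat.succ_eq_add_one, key m, hcn]

namespace IsTracialState

variable {τ : B → ℂ}

lemma re_mono (hτ : IsTracialState τ) {a b : B} (hab : a ≤ b) : (τ a).re ≤ (τ b).re := by
  have h := (hτ.2.2.2.1 (b - a) (sub_nonneg.2 hab)).1
  have h' := hτ.1 (b - a) a
  rw [sub_add_cancel] at h'
  rw [h', Complex.add_re]
  linarith

lemma exists_tendsto_of_le_one (hτ : IsTracialState τ) {a : B} (ha : 0 ≤ a) (ha1 : a ≤ 1) :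
    ∃ l, Tendsto (fun n : ℕ => (τ (a ^ ((n : ℝ)⁻¹))).re) atTop (𝓝 l) := by
  have hspec : ∀ t ∈ spectrum ℝ a, 0 ≤ t ∧ t ≤ 1 := fun t ht =>
    ⟨spectrum_nonneg_of_nonneg ha ht, (CFC.le_one_iff a).1 ha1 t ht⟩
  have hcont : ∀ n : ℕ, ContinuousOn (fun t : ℝ => t ^ ((n : ℝ)⁻¹)) (spectrum ℝ a) := fun n =>
    (Real.continuous_rpow_const (by positivity)).continuousOn
  have hmono : Monotone fun n : ℕ => (τ (a ^ (((n + 1 : ℕ) : ℝ)⁻¹))).re := by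
    refine monotone_nat_of_le_succ fun n => hτ.re_mono ?_
    rw [CFC.rpow_eq_cfc_real ha, CFC.rpow_eq_cfc_real ha]
    refine cfc_mono (fun t ht => ?_) (hcont _) (hcont _)
    refine Real.rpow_le_rpow_of_exponent_ge' (hspec t ht).1 (hspec t ht).2 (by positivity) ?_
    gcongr
    simp
  have hbdd : BddAbove (Set.range fun n : ℕ => (τ (a ^ (((n + 1 : ℕ) : ℝ)⁻¹))).re) := by
    refine ⟨(τ 1).re, ?_⟩
    rintro _ ⟨n, rfl⟩
    refine hτ.re_mono ?_
    rw [CFC.rpow_eq_cfc_real ha]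
    exact cfc_le_one _ _ fun t ht =>
      Real.rpow_le_one (hspec t ht).1 (hspec t ht).2 (by positivity)
  exact ⟨_, (tendsto_add_atTop_iff_nat 1).1 (tendsto_atTop_ciSup hmono hbdd)⟩

lemma exists_tendsto (hτ : IsTracialState τ) {a : B} (ha : 0 ≤ a) :
    ∃ l, Tendsto (fun n : ℕ => (τ (a ^ ((n : ℝ)⁻¹))).re) atTop (𝓝 l) := by
  have hc : 0 < ‖a‖ + 1 := by positivity
  have ha1 : (‖a‖ + 1)⁻¹ • a ≤ 1 := by
    have h : a ≤ (‖a‖ + 1) • (1 : B) := by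
      rw [← Algebra.algebraMap_eq_smul_one]
      refine (IsSelfAdjoint.le_algebraMap_norm_self (.of_nonneg ha)).trans ?_
      exact algebraMap_mono B (by linarith)
    have h' := smul_le_smul_of_nonneg_left h (inv_nonneg.2 hc.le)
    rwa [smul_smul, inv_mul_cancel₀ hc.ne', one_smul] at h'
  have ha0 : 0 ≤ (‖a‖ + 1)⁻¹ • a := smul_nonneg (inv_nonneg.2 hc.le) ha
  obtain ⟨l, hl⟩ := hτ.exists_tendsto_of_le_one ha0 ha1
  refine ⟨1 * l, ((tendsto_const_rpow_inv hc).mul hl).congr fun n => ?_⟩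
  rw [← hτ.re_smul, ← CFC.smul_rpow hc.le (by positivity) ha0, smul_smul,
    mul_inv_cancel₀ hc.ne', one_smul]

lemma tendsto_dTr (hτ : IsTracialState τ) {a : B} (ha : 0 ≤ a) :
    Tendsto (fun n : ℕ => (τ (a ^ ((n : ℝ)⁻¹))).re) atTop (𝓝 (dTr τ a)) := by
  have h := tendsto_nhds_limUnder (hτ.exists_tendsto ha)
  simp only [CFC.rpow_eq_cfc_real ha] at h ⊢
  exact h

lemma dTr_le_of_le_smul (hτ : IsTracialState τ) {a b : B} {c : ℝ} (ha : 0 ≤ a) (hb : 0 ≤ b)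
    (hc : 0 < c) (hab : a ≤ c • b) : dTr τ a ≤ dTr τ b := by
  have h := (tendsto_const_rpow_inv hc).mul (hτ.tendsto_dTr hb)
  rw [one_mul] at h
  refine le_of_tendsto_of_tendsto (hτ.tendsto_dTr ha) h ?_
  filter_upwards [eventually_ge_atTop 1] with n hn
  rw [← hτ.re_smul, ← CFC.smul_rpow hc.le (by positivity) hb]
  refine hτ.re_mono (CFC.rpow_le_rpow ⟨by positivity, ?_⟩ hab)
  exact inv_le_one_of_one_le₀ (by exact_mod_cast hn)

lemma dTr_projection (hτ : IsTracialState τ) {p : B} (hp : IsProjection p) :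
    dTr τ p = (τ p).re := by
  refine tendsto_nhds_unique (hτ.tendsto_dTr hp.nonneg) (tendsto_const_nhds.congr' ?_)
  filter_upwards [eventually_ge_atTop 1] with n hn
  have hn' : n ≠ 0 := by omega
  have h := CFC.pow_rpow_inv hn' hp.nonneg
  rw [(show IsIdempotentElem p from hp.2).pow_eq hn'] at h
  rw [h]

lemma dTr_add_projection (hτ : IsTracialState τ) {p b : B} (hp : IsProjection p) (hb : 0 ≤ b)
    (hbp : b * p = 0) (hpb : p * b = 0) : dTr τ (b + p) = dTr τ b + dTr τ p := by
  rw [hτ.dTr_projection hp]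
  refine tendsto_nhds_unique (hτ.tendsto_dTr (add_nonneg hb hp.nonneg))
    (((hτ.tendsto_dTr hb).add_const _).congr' ?_)
  filter_upwards [eventually_ge_atTop 1] with n hn
  rw [CFC.add_rpow_inv_of_mul_eq_zero hp hb hbp hpb (by omega), hτ.1, Complex.add_re]

end IsTracialState

/-- If a projection is Cuntz below a positive element `f`, it is of the form `u * f * star u`. -/
lemma IsProjection.exists_conj_eq_of_cuntzLE {q f : B} (hq : IsProjection q) (hf : 0 ≤ f)
    (h : CuntzLE q f) : ∃ u : B, q * u = u ∧ u * f * star u = q := by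
  obtain ⟨v, hv⟩ := h
  obtain ⟨n, hn⟩ := (hv.eventually (gt_mem_nhds one_pos)).exists
  set x := q * (v n * f * star (v n)) * q with hx
  have hx0 : 0 ≤ x := by
    have h1 : 0 ≤ v n * f * star (v n) := star_right_conjugate_nonneg hf _
    have h2 := star_right_conjugate_nonneg h1 q
    rwa [hq.1] at h2
  have hqx : q * x = x := by rw [hx, ← mul_assoc, ← mul_assoc, hq.2]
  have hxq : x * q = x := by rw [hx, mul_assoc, hq.2]
  have hq1 : ‖q‖ ≤ 1 := by
    have h1 : ‖q‖ * ‖q‖ = ‖q‖ := by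
      rw [← CStarRing.norm_star_mul_self, hq.1, hq.2]
    nlinarith [norm_nonneg q]
  have hxn : ‖x - q‖ < 1 := by
    have h1 : x - q = q * (v n * f * star (v n) - q) * q := by
      rw [mul_sub, sub_mul, hq.2, hq.2]
    rw [h1]
    refine lt_of_le_of_lt (norm_mul_le _ _) (lt_of_le_of_lt ?_ hn)
    calc _ ≤ ‖q‖ * ‖v n * f * star (v n) - q‖ * ‖q‖ := by gcongr; exact norm_mul_le _ _
      _ ≤ 1 * ‖v n * f * star (v n) - q‖ * 1 := by gcongr
      _ = _ := by ring
  set y := x + (1 - q) with hy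
  have hy0 : 0 ≤ y := add_nonneg hx0 hq.one_sub.nonneg
  have hyu : IsUnit y := by
    have h1 : ‖1 - y‖ < 1 := by
      rw [norm_sub_rev]
      rwa [show y - 1 = x - q by rw [hy]; abel]
    have h2 := (Units.oneSub (1 - y) h1).isUnit
    simpa using h2
  have hcomm : Commute y q := by
    show y * q = q * y
    rw [hy, add_mul, mul_add, hxq, hqx, sub_mul, mul_sub]; simp
  set r := y ^ (-(1 / 2) : ℝ) with hr
  have hr0 : 0 ≤ r := CFC.rpow_nonneg
  have hrq : r * q = q * r := by
    rw [hr, CFC.rpow_def]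
    exact Commute.cfc_nnreal hcomm _
  have hryr : r * y * r = 1 := by
    calc r * y * r = r * y ^ (1 : ℝ) * r := by rw [CFC.rpow_one y]
      _ = y ^ (0 : ℝ) := by
        rw [hr, ← CFC.rpow_add hyu, ← CFC.rpow_add hyu]
        norm_num
      _ = 1 := CFC.rpow_zero y
  refine ⟨r * q * v n, ?_, ?_⟩
  · rw [← mul_assoc, ← mul_assoc, ← hrq, mul_assoc r, hq.2]
  · have hyx : y * q = x := by
      rw [hy, add_mul, hxq, sub_mul, one_mul, hq.2, sub_self, add_zero]
    calc r * q * v n * f * star (r * q * v n) = r * x * r := by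
          rw [star_mul, star_mul, hq.1, (IsSelfAdjoint.of_nonneg hr0).star_eq, hx]
          simp only [mul_assoc]
      _ = r * y * r * q := by rw [← hyx, mul_assoc _ r q, hrq]; simp only [mul_assoc]
      _ = q := by rw [hryr, one_mul]

lemma sqrt_mul_mul_sqrt_mem_herSet {f : B} (hf : 0 ≤ f) (y : B) :
    CFC.sqrt f * y * CFC.sqrt f ∈ herSet f := by
  set s : ℕ → ℝ → ℝ := fun n t => √t / (t + 1 / ((n : ℝ) + 1)) with hs
  have hpos : ∀ t ∈ spectrum ℝ f, 0 ≤ t := fun t ht => spectrum_nonneg_of_nonneg hf ht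
  have hcont : ∀ n, ContinuousOn (s n) (spectrum ℝ f) := fun n =>
    Real.continuous_sqrt.continuousOn.div (by fun_prop) fun t ht =>
      (add_pos_of_nonneg_of_pos (hpos t ht) (by positivity)).ne'
  have hle : ∀ n : ℕ, ‖f * cfc (s n) f - CFC.sqrt f‖ ≤ √(1 / ((n : ℝ) + 1)) := by
    intro n
    have h1 : f * cfc (s n) f - CFC.sqrt f = cfc (fun t => t * s n t - √t) f := by
      rw [CFC.sqrt_eq_real_sqrt f, cfcₙ_eq_cfc (hf := Real.continuous_sqrt.continuousOn),
        cfc_sub (fun t => t * s n t) _ f (continuousOn_id.mul (hcont n))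
          Real.continuous_sqrt.continuousOn,
        cfc_mul (fun t => t) _ f continuousOn_id (hcont n), cfc_id' ℝ f]
    rw [h1]
    refine norm_cfc_le (by positivity) fun t ht => ?_
    have ht0 := hpos t ht
    set e : ℝ := 1 / ((n : ℝ) + 1) with he
    have he0 : 0 < e := by positivity
    have h2 : t * s n t - √t = -(√t * e / (t + e)) := by
      simp only [hs, ← he]
      field_simp
      ring
    rw [h2, norm_neg, Real.norm_of_nonneg (by positivity), div_le_iff₀ (by positivity)]
    have h3 := Real.sq_sqrt ht0
    have h4 := Real.sq_sqrt he0.le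
    have h5 := Real.sqrt_nonneg t
    have h6 := Real.sqrt_nonneg e
    nlinarith [mul_nonneg h6 (sq_nonneg (√t - √e)), mul_nonneg h6 (mul_nonneg h5 h6),
      mul_nonneg h6 h6, mul_nonneg h6 (sq_nonneg (√t)), mul_nonneg h6 (sq_nonneg (√e))]
  have hlim : Tendsto (fun n : ℕ => f * cfc (s n) f) atTop (𝓝 (CFC.sqrt f)) := by
    rw [tendsto_iff_norm_sub_tendsto_zero]
    refine squeeze_zero (fun _ => norm_nonneg _) hle ?_
    have h := (Real.continuous_sqrt.tendsto 0).comp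
      (tendsto_one_div_add_atTop_nhds_zero_nat (𝕜 := ℝ))
    rwa [Real.sqrt_zero] at h
  refine mem_closure_of_tendsto ((hlim.mul_const y).mul hlim) (Eventually.of_forall fun n => ?_)
  refine ⟨cfc (s n) f * y * cfc (s n) f, ?_⟩
  have hc : f * cfc (s n) f = cfc (s n) f * f :=
    (Commute.cfc_real (Commute.refl f) _).symm.eq
  calc _ = f * cfc (s n) f * y * (cfc (s n) f * f) := by rw [hc]
    _ = _ := by simp only [mul_assoc]

lemma StrictComparison.exists_split_off_projection (hSC : StrictComparison B) {f q : B}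
    (hf : 0 ≤ f) (hq : IsProjection q)
    (hlt : ∀ τ : B → ℂ, IsTracialState τ → dTr τ q < dTr τ f) :
    ∃ p b : B, IsProjection p ∧ MvNEquiv p q ∧
      0 ≤ b ∧ b ∈ herSet f ∧ b * p = 0 ∧ p * b = 0 ∧
      ∀ τ : B → ℂ, IsTracialState τ → dTr τ f = dTr τ b + dTr τ p := by
  obtain ⟨u, hqu, hu⟩ := hq.exists_conj_eq_of_cuntzLE hf (hSC q f hq.nonneg hf hlt)
  set g := CFC.sqrt f with hg
  have hgs : star g = g := (IsSelfAdjoint.of_nonneg (CFC.sqrt_nonneg f)).star_eq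
  have hgg : g * g = f := CFC.sqrt_mul_sqrt_self f hf
  set p := g * (star u * u) * g with hpdef
  have hp : IsProjection p := by
    refine ⟨by simp only [hpdef, star_mul, star_star, hgs, mul_assoc], ?_⟩
    calc p * p = g * (star u * (u * (g * g) * star u * u)) * g := by
          simp only [hpdef, mul_assoc]
      _ = p := by rw [hgg, hu, hqu]
  have hmvn : MvNEquiv p q := by
    refine ⟨u * g, ?_, ?_⟩
    · simp only [hpdef, star_mul, hgs, mul_assoc]
    · rw [star_mul, hgs, ← hu, ← hgg]
      simp only [mul_assoc]
  set b := (1 - p) * f * (1 - p) with hbdef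
  have hb : 0 ≤ b := by
    have h := star_right_conjugate_nonneg hf (1 - p)
    rwa [hp.one_sub.1] at h
  have hbp : b * p = 0 := by
    rw [hbdef, mul_assoc, sub_mul 1 p p, hp.2, one_mul, sub_self, mul_zero]
  have hpb : p * b = 0 := by
    rw [hbdef, ← mul_assoc, ← mul_assoc, mul_sub p 1 p, hp.2, mul_one, sub_self, zero_mul, zero_mul]
  have hher : b ∈ herSet f := by
    have h : b = g * ((1 - star u * u * f) * (1 - f * (star u * u))) * g := by
      rw [hbdef, hpdef, ← hgg]
      noncomm_ring
    rw [h]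
    exact sqrt_mul_mul_sqrt_mem_herSet hf _
  have hpf : p ≤ ‖u‖ ^ 2 • f := by
    have h := star_right_conjugate_le_conjugate
      (CStarAlgebra.star_mul_le_algebraMap_norm_sq (a := u)) g
    rw [hgs, Algebra.algebraMap_eq_smul_one, mul_smul_comm, mul_one, smul_mul_assoc, hgg] at h
    exact h
  have hpfp : p * f * p ≤ ‖f‖ • p := by
    have h := CStarAlgebra.star_right_conjugate_le_norm_smul (a := p) (b := f) (.of_nonneg hf)
    rwa [hp.1, hp.2] at h
  have hpfp0 : 0 ≤ p * f * p := by
    have h := star_right_conjugate_nonneg hf p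
    rwa [hp.1] at h
  have hsum : f ≤ (2 : ℝ) • (p * f * p + b) := by
    have h := star_right_conjugate_nonneg hf (p - (1 - p))
    rw [star_sub, hp.1, hp.one_sub.1] at h
    rw [← sub_nonneg]
    convert h using 1
    rw [hbdef, two_smul]
    noncomm_ring
  have hbf : b ≤ (2 : ℝ) • (p * f * p + f) := by
    have h := star_right_conjugate_nonneg hf (1 + p)
    rw [star_add, star_one, hp.1] at h
    rw [← sub_nonneg]
    convert h using 1
    rw [hbdef, two_smul]
    noncomm_ring
  have h1 : b + p ≤ (2 * (‖f‖ * ‖u‖ ^ 2) + 2 + ‖u‖ ^ 2) • f := by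
    have h2 : p * f * p ≤ (‖f‖ * ‖u‖ ^ 2) • f := by
      rw [mul_smul]
      exact hpfp.trans (smul_le_smul_of_nonneg_left hpf (norm_nonneg f))
    calc b + p ≤ (2 : ℝ) • ((‖f‖ * ‖u‖ ^ 2) • f + f) + ‖u‖ ^ 2 • f := by
          refine add_le_add (hbf.trans ?_) hpf
          exact smul_le_smul_of_nonneg_left (by gcongr) zero_le_two
      _ = _ := by module
  have h2 : f ≤ (2 * (‖f‖ + 1)) • (b + p) := by
    have h3 : p * f * p + b ≤ (‖f‖ + 1) • (b + p) := by
      have h4 : (‖f‖ + 1) • (b + p) = (‖f‖ • p + b) + (‖f‖ • b + p) := by module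
      rw [h4]
      refine le_add_of_le_of_nonneg (by gcongr) ?_
      exact add_nonneg (smul_nonneg (norm_nonneg f) hb) hp.nonneg
    rw [mul_smul]
    exact hsum.trans (smul_le_smul_of_nonneg_left h3 zero_le_two)
  refine ⟨p, b, hp, hmvn, hb, hher, hbp, hpb, fun τ hτ => ?_⟩
  rw [← hτ.dTr_add_projection hp hb hbp hpb]
  have hbp0 : 0 ≤ b + p := add_nonneg hb hp.nonneg
  exact le_antisymm (hτ.dTr_le_of_le_smul hf hbp0 (by positivity) h2)
    (hτ.dTr_le_of_le_smul hbp0 hf (by positivity) h1)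

end CStar

/-- **Lemma (splitting off a projection).**
Let `A` be unital simple separable, approximately divisible and stably finite, `X`
a compact metric space, and suppose `C(X,A)` has strict comparison.  If
`f ∈ C(X,A)` is positive and `q ∈ C(X,A)` is a projection with `d_τ(q) < d_τ(f)`
for every tracial state `τ` on `C(X,A)`, then there are a projection `p ∼ q`
(Murray–von Neumann) and a positive `b` in the closure of `f·C(X,A)·f` with
`bp = pb = 0` and `d_τ(f) = d_τ(b) + d_τ(p)` for every tracial state `τ`. -/
theorem split_off_projection
    {A : Type*} [CStarAlgebra A] [PartialOrder A] [StarOrderedRing A]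
    [TopologicalSpace.SeparableSpace A]
    (hSimple : CStarSimple A) (hAD : ApproxDivisible A) (hSF : StablyFinite A)
    (X : Type*) [MetricSpace X] [CompactSpace X]
    (hSC : StrictComparison C(X, A))
    (f : C(X, A)) (hf : 0 ≤ f)
    (q : C(X, A)) (hq : IsProjection q)
    (hlt : ∀ τ : C(X, A) → ℂ, IsTracialState τ → dTr τ q < dTr τ f) :
    ∃ p b : C(X, A), IsProjection p ∧ MvNEquiv p q ∧
      0 ≤ b ∧ b ∈ herSet f ∧ b * p = 0 ∧ p * b = 0 ∧
      ∀ τ : C(X, A) → ℂ, IsTracialState τ → dTr τ f = dTr τ b + dTr τ p :=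
  hSC.exists_split_off_projection hf hq hlt
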